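/- The eigenvalues of the non-binary Johnson scheme satisfy the difference relation in the first variable: for integers r ≥ 3 and 1 ≤ k ≤ n−1, for all (i,j) ∈ ℕ² with i+j ≤ k and j ≤ n−k, and all integers x, y ≥ 0 with x+y ≤ k and y ≤ n−k, provided 2y+x−n ∉ {0, 1, 2}, one has i·p_{ij}(x,y) = P₁·p_{ij}(x+1,y) + P₂·p_{ij}(x+1,y−1) + P₃·p_{ij}(x−1,y) + P₄·p_{ij}(x−1,y+1) + P₅·p_{ij}(x,y−1) + P₆·p_{ij}(x,y+1) + P₇·p_{ij}(x,y), where P₁ = −(r−2)(n−x−y+1)(k−x−y)/((r−1)(n−x−2y+1)), P₂ = y(r−2)(y+k−n−1)/((r−1)(n−x−2y+1)), P₃ = −(k−x+1−y)x/((r−1)(n−x−2y+1)), P₄ = x(y+k−n)/((r−1)(n−x−2y+1)), P₅ = −((r−2)/(r−1))·D, P₆ = −((r−2)/(r−1))·B, P₇ = −(P₁+P₂+P₃+P₄+P₅+P₆), with B = (y+x−k)(y+x−n−1)(y+k−n)/((2y+x−n)(2y+x−n−1)) and D = −y(y+x−k−1)(y+k−n−1)/((2y+x−n−1)(2y+x−n−2)).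 -/

import Mathlib

/-- Generalized binomial coefficient `C(z, l) = z (z-1) ⋯ (z-l+1) / l!` for `z : ℚ`. -/
noncomputable def qchoose (z : ℚ) (l : ℕ) : ℚ :=
  (∏ m ∈ Finset.range l, (z - m)) / (Nat.factorial l : ℚ)

/-- Krawtchouk polynomial `K_i(x, N, p)`. -/
noncomputable def Kraw (i : ℕ) (x N p : ℚ) : ℚ :=
  ∑ l ∈ Finset.range (i + 1),
    (-1 : ℚ) ^ l * (p - 1) ^ (i - l) * qchoose x l * qchoose (N - x) (i - l)

/-- Eberlein polynomial `E_i(x, N, p)`. -/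
noncomputable def Eber (i : ℕ) (x N p : ℚ) : ℚ :=
  ∑ l ∈ Finset.range (i + 1),
    (-1 : ℚ) ^ l * qchoose x l * qchoose (p - x) (i - l) * qchoose (N - p - x) (i - l)

/-- Hahn polynomial `H_i(x, N, p) = ((C(N,i) - C(N,i-1)) / (C(p,x) C(N-p,x))) E_x(i, N, p)`,
with the convention `C(N, -1) = 0`. -/
noncomputable def Hahn (i x : ℕ) (N p : ℚ) : ℚ :=
  ((qchoose N i - if i = 0 then 0 else qchoose N (i - 1)) / (qchoose p x * qchoose (N - p) x))
    * Eber x (i : ℚ) N p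

/-- Krawtchouk polynomial with an integer index, with the convention `K_{-1} := 0`. -/
noncomputable def KrawZ (i : ℤ) (x N p : ℚ) : ℚ :=
  if i < 0 then 0 else Kraw i.toNat x N p

/-- Hahn polynomial with an integer index, with the convention `H_{-1} := 0`. -/
noncomputable def HahnZ (i : ℤ) (x : ℕ) (N p : ℚ) : ℚ :=
  if i < 0 then 0 else Hahn i.toNat x N p

/-- Eigenvalues `p_{ij}(x, y)` of the non-binary Johnson scheme `J_r(k, n)`,
as a polynomial expression in `(x, y)` evaluated in `ℚ`. -/
noncomputable def peig (r n k : ℤ) (i j : ℕ) (x y : ℚ) : ℚ :=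
  ((r : ℚ) - 1) ^ j * Kraw i x ((k : ℚ) - j) ((r : ℚ) - 1) * Eber j y ((n : ℚ) - x) ((k : ℚ) - x)

open Finset Finset.Nat in
/-- Two antidiagonal sums agree if their terms agree up to a shift by `(1, -1)`. -/
theorem sum_antidiagonal_shift {M : Type*} [AddCommMonoid M] (F G : ℕ → ℕ → M) (j : ℕ)
    (hF : ∀ d, F 0 d = 0) (hG : ∀ l, G l 0 = 0) (h : ∀ l d, F (l + 1) d = G l (d + 1)) :
    ∑ q ∈ antidiagonal j, F q.1 q.2 = ∑ q ∈ antidiagonal j, G q.1 q.2 := by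
  cases j with
  | zero => simp [hF, hG]
  | succ j =>
    rw [sum_antidiagonal_succ, sum_antidiagonal_succ' (f := fun q => G q.1 q.2)]
    simp [hF, hG, h]

theorem qchoose_zero (z : ℚ) : qchoose z 0 = 1 := by simp [qchoose]

theorem qchoose_succ (z : ℚ) (l : ℕ) :
    ((l : ℚ) + 1) * qchoose z (l + 1) = (z - l) * qchoose z l := by
  have h : (Nat.factorial l : ℚ) ≠ 0 := by exact_mod_cast Nat.factorial_ne_zero l
  have h' : (l : ℚ) + 1 ≠ 0 := by positivity
  simp only [qchoose, Finset.prod_range_succ, Nat.factorial_succ]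
  push_cast
  field_simp

theorem qchoose_add_one_mul (z : ℚ) (l : ℕ) :
    (z + 1 - l) * qchoose (z + 1) l = (z + 1) * qchoose z l := by
  induction l with
  | zero => simp [qchoose_zero]
  | succ l ih =>
    have h' : (l : ℚ) + 1 ≠ 0 := by positivity
    have h1 := qchoose_succ z l
    have h2 := qchoose_succ (z + 1) l
    apply mul_left_cancel₀ h'
    push_cast
    linear_combination (z - l) * h2 + (z - l) * ih - (z + 1) * h1

theorem qchoose_pascal (z : ℚ) (l : ℕ) :
    qchoose (z + 1) (l + 1) = qchoose z (l + 1) + qchoose z l := by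
  have h' : (l : ℚ) + 1 ≠ 0 := by positivity
  apply mul_left_cancel₀ h'
  linear_combination qchoose_succ (z + 1) l - qchoose_succ z l + qchoose_add_one_mul z l

theorem qchoose_sub_one_mul (z : ℚ) (l : ℕ) :
    z * qchoose (z - 1) l = (z - l) * qchoose z l := by
  have h := qchoose_add_one_mul (z - 1) l
  rw [sub_add_cancel] at h
  exact h.symm

theorem qchoose_pascal_sub_one (z : ℚ) (l : ℕ) :
    qchoose z (l + 1) = qchoose (z - 1) (l + 1) + qchoose (z - 1) l := by
  have h := qchoose_pascal (z - 1) l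
  rwa [sub_add_cancel] at h

theorem Kraw_eq_sum_antidiagonal (i : ℕ) (x N p : ℚ) :
    Kraw i x N p = ∑ q ∈ Finset.HasAntidiagonal.antidiagonal i,
      (-1) ^ q.1 * (p - 1) ^ q.2 * qchoose x q.1 * qchoose (N - x) q.2 :=
  (Finset.Nat.sum_antidiagonal_eq_sum_range_succ
    (fun l d => (-1) ^ l * (p - 1) ^ d * qchoose x l * qchoose (N - x) d) i).symm

/-- The sum defining the Eberlein polynomial `E_j(y, N, p)`, in the variables `a = p - y` and
`b = N - p - y`. -/
noncomputable def eberSum (j : ℕ) (y a b : ℚ) : ℚ :=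
  ∑ q ∈ Finset.HasAntidiagonal.antidiagonal j, (-1) ^ q.1 * qchoose y q.1 * qchoose a q.2 * qchoose b q.2

theorem Eber_eq_eberSum {j : ℕ} {y N p a b : ℚ} (ha : p - y = a) (hb : N - p - y = b) :
    Eber j y N p = eberSum j y a b := by
  subst ha hb
  exact (Finset.Nat.sum_antidiagonal_eq_sum_range_succ
    (fun l d => (-1) ^ l * qchoose y l * qchoose (p - y) d * qchoose (N - p - y) d) j).symm

/-- The difference equation of the Krawtchouk polynomials. -/
theorem Kraw_difference (i : ℕ) (x N p : ℚ) :
    p * i * Kraw i x N p = -x * Kraw i (x - 1) N p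
      + ((p - 1) * (N - x) + x) * Kraw i x N p - (p - 1) * (N - x) * Kraw i (x + 1) N p := by
  obtain ⟨s, rfl⟩ : ∃ s, p = s + 1 := ⟨p - 1, by ring⟩
  obtain ⟨c, rfl⟩ : ∃ c, N = c + x := ⟨N - x, by ring⟩
  simp only [Kraw_eq_sum_antidiagonal, add_sub_cancel_right,
    show c + x - (x - 1) = c + 1 by ring, show c + x - (x + 1) = c - 1 by ring]
  have key₁ := sum_antidiagonal_shift
    (fun l d => (-1) ^ l * s ^ d * s * (l * qchoose x l) * qchoose c d)
    (fun l d => -((-1) ^ l * s ^ d * ((x - l) * qchoose x l) * (qchoose (c + 1) d - qchoose c d)))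
    i (by simp) (by simp [qchoose_zero]) (by
      intro l d
      rw [qchoose_pascal c d]
      push_cast
      rw [qchoose_succ]
      ring)
  have key₂ := sum_antidiagonal_shift
    (fun l d => (-1) ^ l * s ^ d * s * (qchoose (x + 1) l - qchoose x l) * ((c - d) * qchoose c d))
    (fun l d => -((-1) ^ l * s ^ d * qchoose x l * (d * qchoose c d)))
    i (by simp [qchoose_zero]) (by simp) (by
      intro l d
      rw [qchoose_pascal x l]
      push_cast
      rw [qchoose_succ]
      ring)
  rw [← sub_eq_zero]
  have key := congrArg₂ (· + ·) (sub_eq_zero.2 key₁) (sub_eq_zero.2 key₂)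
  rw [add_zero] at key
  rw [← key]
  simp only [Finset.mul_sum, ← Finset.sum_sub_distrib, ← Finset.sum_add_distrib]
  refine Finset.sum_congr rfl fun q hq => ?_
  obtain ⟨l, d⟩ := q
  obtain rfl : l + d = i := by simpa using hq
  push_cast
  linear_combination (-1) ^ l * s ^ d * qchoose (c + 1) d * qchoose_sub_one_mul x l
    + (-1) ^ l * s ^ d * s * qchoose (x + 1) l * qchoose_sub_one_mul c d

theorem eberSum_raise (j : ℕ) (y a b : ℚ) :
    (a + 1) * eberSum j y (a + 1) b + b * eberSum j (y + 1) a (b - 1)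
      = (a + b + 1) * eberSum j y a b := by
  have key := sum_antidiagonal_shift
    (fun l d => (-1) ^ l * (qchoose (y + 1) l - qchoose y l) * (b * qchoose a d * qchoose (b - 1) d))
    (fun l d => -((-1) ^ l * qchoose y l *
      (b * (qchoose (a + 1) d - qchoose a d) * (qchoose b d - qchoose (b - 1) d))))
    j (by simp [qchoose_zero]) (by simp [qchoose_zero]) (by
      intro l d
      rw [qchoose_pascal y l, qchoose_pascal a d, qchoose_pascal_sub_one b d]
      ring)
  unfold eberSum
  rw [← sub_eq_zero] at key ⊢
  rw [← key]
  simp only [Finset.mul_sum, ← Finset.sum_sub_distrib, ← Finset.sum_add_distrib]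
  refine Finset.sum_congr rfl fun q _ => ?_
  obtain ⟨l, d⟩ := q
  linear_combination (-1) ^ l * qchoose y l * (qchoose b d * qchoose_add_one_mul a d
    + qchoose (a + 1) d * qchoose_sub_one_mul b d)

theorem eberSum_lower (j : ℕ) (y a b : ℚ) :
    (a + b + y + 1) * a * eberSum j y (a - 1) b + y * (b + 1) * eberSum j (y - 1) a (b + 1)
      = (a + b + 1) * (a + y - j) * eberSum j y a b := by
  have key := sum_antidiagonal_shift
    (fun l d => (-1) ^ l * (l * qchoose y l) * ((a - d) * qchoose a d * qchoose b d))
    (fun l d => -((-1) ^ l * ((y - l) * qchoose y l) *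
      (d * qchoose a d * (qchoose (b + 1) d - qchoose b d))))
    j (by simp) (by simp) (by
      intro l d
      rw [qchoose_pascal b d]
      push_cast
      rw [qchoose_succ, qchoose_succ]
      ring)
  unfold eberSum
  rw [← sub_eq_zero] at key ⊢
  rw [← key]
  simp only [Finset.mul_sum, ← Finset.sum_sub_distrib, ← Finset.sum_add_distrib]
  refine Finset.sum_congr rfl fun q hq => ?_
  obtain ⟨l, d⟩ := q
  obtain rfl : l + d = j := by simpa using hq
  push_cast
  linear_combination (-1) ^ l * (a + b + y + 1) * qchoose y l * qchoose b d
      * qchoose_sub_one_mul a d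
    + (-1) ^ l * (b + 1) * qchoose a d * qchoose (b + 1) d * qchoose_sub_one_mul y l
    + (-1) ^ l * (y - l) * qchoose y l * qchoose a d * qchoose_add_one_mul b d

theorem Eber_raise (j : ℕ) (y N p : ℚ) :
    (p - y + 1) * Eber j y (N + 1) (p + 1) + (N - p - y) * Eber j (y + 1) (N + 1) (p + 1)
      = (N - 2 * y + 1) * Eber j y N p := by
  rw [Eber_eq_eberSum (a := p - y + 1) (b := N - p - y) (by ring) (by ring),
    Eber_eq_eberSum (y := y + 1) (a := p - y) (b := N - p - y - 1) (by ring) (by ring),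
    Eber_eq_eberSum (a := p - y) (b := N - p - y) rfl rfl, eberSum_raise]
  ring

theorem Eber_lower (j : ℕ) (y N p : ℚ) :
    (N - y + 1) * (p - y) * Eber j y (N - 1) (p - 1)
        + y * (N - p - y + 1) * Eber j (y - 1) (N - 1) (p - 1)
      = (N - 2 * y + 1) * (p - j) * Eber j y N p := by
  rw [Eber_eq_eberSum (a := p - y - 1) (b := N - p - y) (by ring) (by ring),
    Eber_eq_eberSum (y := y - 1) (a := p - y) (b := N - p - y + 1) (by ring) (by ring),
    Eber_eq_eberSum (a := p - y) (b := N - p - y) rfl rfl]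
  linear_combination eberSum_lower j y (p - y) (N - p - y)

/-- The difference equation of the Eberlein polynomials, with eigenvalue `j`. -/
theorem Eber_difference (j : ℕ) (y N p : ℚ)
    (h0 : N - 2 * y ≠ 0) (h1 : N - 2 * y + 1 ≠ 0) (h2 : N - 2 * y + 2 ≠ 0) :
    -((N - y + 1) * (p - y) * (N - p - y) / ((N - 2 * y) * (N - 2 * y + 1)))
          * (Eber j (y + 1) N p - Eber j y N p)
        - y * (p - y + 1) * (N - p - y + 1) / ((N - 2 * y + 1) * (N - 2 * y + 2))
          * (Eber j (y - 1) N p - Eber j y N p)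
      = j * Eber j y N p := by
  have hl := Eber_lower j y N p
  have hr := Eber_raise j y (N - 1) (p - 1)
  have hr' := Eber_raise j (y - 1) (N - 1) (p - 1)
  simp only [sub_add_cancel] at hr hr'
  generalize hd : N - 2 * y = d at *
  field_simp
  subst hd
  linear_combination
    -(N - 2 * y) * (N - 2 * y + 2) * hl
      - (N - y + 1) * (p - y) * (N - 2 * y + 2) * hr
      - y * (N - p - y + 1) * (N - 2 * y) * hr'

/-- Difference relation in the first variable for the eigenvalues of the
non-binary Johnson scheme. -/
theorem peig_difference_first (r n k : ℤ) (hr : 3 ≤ r) (hk1 : 1 ≤ k) (hkn : k ≤ n - 1)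
    (i j : ℕ) (hij : (i : ℤ) + j ≤ k) (hj : (j : ℤ) ≤ n - k)
    (x y : ℤ) (hx : 0 ≤ x) (hy : 0 ≤ y) (hxy : x + y ≤ k) (hyk : y ≤ n - k)
    (h0 : 2 * y + x - n ≠ 0) (h1 : 2 * y + x - n ≠ 1) (h2 : 2 * y + x - n ≠ 2)
    (B D P1 P2 P3 P4 P5 P6 P7 : ℚ)
    (hB : B = ((y : ℚ) + x - k) * ((y : ℚ) + x - n - 1) * ((y : ℚ) + k - n)
        / ((2 * (y : ℚ) + x - n) * (2 * (y : ℚ) + x - n - 1)))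
    (hD : D = -((y : ℚ) * ((y : ℚ) + x - k - 1) * ((y : ℚ) + k - n - 1)
        / ((2 * (y : ℚ) + x - n - 1) * (2 * (y : ℚ) + x - n - 2))))
    (hP1 : P1 = -(((r : ℚ) - 2) * ((n : ℚ) - x - y + 1) * ((k : ℚ) - x - y)
        / (((r : ℚ) - 1) * ((n : ℚ) - x - 2 * y + 1))))
    (hP2 : P2 = (y : ℚ) * ((r : ℚ) - 2) * ((y : ℚ) + k - n - 1)
        / (((r : ℚ) - 1) * ((n : ℚ) - x - 2 * y + 1)))
    (hP3 : P3 = -(((k : ℚ) - x + 1 - y) * x / (((r : ℚ) - 1) * ((n : ℚ) - x - 2 * y + 1))))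
    (hP4 : P4 = (x : ℚ) * ((y : ℚ) + k - n) / (((r : ℚ) - 1) * ((n : ℚ) - x - 2 * y + 1)))
    (hP5 : P5 = -(((r : ℚ) - 2) / ((r : ℚ) - 1)) * D)
    (hP6 : P6 = -(((r : ℚ) - 2) / ((r : ℚ) - 1)) * B)
    (hP7 : P7 = -(P1 + P2 + P3 + P4 + P5 + P6)) :
    (i : ℚ) * peig r n k i j x y
  = P1 * peig r n k i j ((x : ℚ) + 1) y
    + P2 * peig r n k i j ((x : ℚ) + 1) ((y : ℚ) - 1)
    + P3 * peig r n k i j ((x : ℚ) - 1) y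
    + P4 * peig r n k i j ((x : ℚ) - 1) ((y : ℚ) + 1)
    + P5 * peig r n k i j x ((y : ℚ) - 1)
    + P6 * peig r n k i j x ((y : ℚ) + 1)
    + P7 * peig r n k i j x y := by
  have h0' : (n : ℚ) - x - 2 * y ≠ 0 := by
    intro h
    apply h0
    have : (2 * y + x - n : ℚ) = 0 := by linear_combination -h
    exact_mod_cast this
  have h1' : (n : ℚ) - x - 2 * y + 1 ≠ 0 := by
    intro h
    apply h1
    have : (2 * y + x - n : ℚ) = 1 := by linear_combination -h
    exact_mod_cast this
  have h2' : (n : ℚ) - x - 2 * y + 2 ≠ 0 := by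
    intro h
    apply h2
    have : (2 * y + x - n : ℚ) = 2 := by linear_combination -h
    exact_mod_cast this
  have hq : (r : ℚ) - 1 ≠ 0 := by
    have : (3 : ℚ) ≤ r := by exact_mod_cast hr
    linarith
  have hK := Kraw_difference i x ((k : ℚ) - j) ((r : ℚ) - 1)
  have hlower := Eber_lower j y ((n : ℚ) - x) ((k : ℚ) - x)
  have hraise := Eber_raise j y ((n : ℚ) - x) ((k : ℚ) - x)
  have hdiff := Eber_difference j y ((n : ℚ) - x) ((k : ℚ) - x) h0' h1' h2'
  have hBdiv : B = -(((n : ℚ) - x - y + 1) * ((k : ℚ) - x - y) * ((n : ℚ) - x - (k - x) - y)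
      / (((n : ℚ) - x - 2 * y) * ((n : ℚ) - x - 2 * y + 1))) := by
    rw [hB, show (2 * (y : ℚ) + x - n) * (2 * (y : ℚ) + x - n - 1)
      = ((n : ℚ) - x - 2 * y) * ((n : ℚ) - x - 2 * y + 1) by ring]
    ring
  have hDdiv : D = -((y : ℚ) * ((k : ℚ) - x - y + 1) * ((n : ℚ) - x - (k - x) - y + 1)
      / (((n : ℚ) - x - 2 * y + 1) * ((n : ℚ) - x - 2 * y + 2))) := by
    rw [hD, show (2 * (y : ℚ) + x - n - 1) * (2 * (y : ℚ) + x - n - 2)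
      = ((n : ℚ) - x - 2 * y + 1) * ((n : ℚ) - x - 2 * y + 2) by ring]
    ring
  rw [← hBdiv, sub_eq_add_neg, ← neg_mul, ← hDdiv] at hdiff
  simp only [peig]
  simp only [show (n : ℚ) - (x + 1) = n - x - 1 by ring, show (k : ℚ) - (x + 1) = k - x - 1 by ring,
    show (n : ℚ) - (x - 1) = n - x + 1 by ring, show (k : ℚ) - (x - 1) = k - x + 1 by ring]
  set E := Eber j y ((n : ℚ) - x) ((k : ℚ) - x)
  have h12 : ((r : ℚ) - 1) * (P1 * Eber j y ((n : ℚ) - x - 1) ((k : ℚ) - x - 1)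
      + P2 * Eber j ((y : ℚ) - 1) ((n : ℚ) - x - 1) ((k : ℚ) - x - 1))
      = -((r : ℚ) - 2) * ((k : ℚ) - x - j) * E := by
    rw [hP1, hP2]
    field_simp
    linear_combination -((r : ℚ) - 2) * hlower
  have h34 : ((r : ℚ) - 1) * (P3 * Eber j y ((n : ℚ) - x + 1) ((k : ℚ) - x + 1)
      + P4 * Eber j ((y : ℚ) + 1) ((n : ℚ) - x + 1) ((k : ℚ) - x + 1)) = -x * E := by
    rw [hP3, hP4]
    generalize hd : (n : ℚ) - x - 2 * y + 1 = d at h1' ⊢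
    field_simp
    subst hd
    linear_combination -(x : ℚ) * hraise
  have h12' : ((r : ℚ) - 1) * (P1 + P2) = -((r : ℚ) - 2) * ((k : ℚ) - x) := by
    rw [hP1, hP2]
    field_simp
    ring
  have h34' : ((r : ℚ) - 1) * (P3 + P4) = -x := by
    rw [hP3, hP4]
    generalize hd : (n : ℚ) - x - 2 * y + 1 = d at h1' ⊢
    field_simp
    subst hd
    ring
  have h5 : ((r : ℚ) - 1) * P5 = -((r : ℚ) - 2) * D := by
    rw [hP5]
    field_simp
  have h6 : ((r : ℚ) - 1) * P6 = -((r : ℚ) - 2) * B := by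
    rw [hP6]
    field_simp
  apply mul_left_cancel₀ hq
  set w := ((r : ℚ) - 1) ^ j
  set K := Kraw i x ((k : ℚ) - j) ((r : ℚ) - 1)
  rw [hP7]
  linear_combination w * E * hK
    - w * Kraw i ((x : ℚ) + 1) ((k : ℚ) - j) ((r : ℚ) - 1) * h12
    - w * Kraw i ((x : ℚ) - 1) ((k : ℚ) - j) ((r : ℚ) - 1) * h34
    + w * K * E * (h12' + h34' + h5 + h6)
    - w * K * (Eber j ((y : ℚ) - 1) ((n : ℚ) - x) ((k : ℚ) - x) * h5
      + Eber j ((y : ℚ) + 1) ((n : ℚ) - x) ((k : ℚ) - x) * h6)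
    + ((r : ℚ) - 2) * w * K * hdiff
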